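/- Let t be a positive squarefree integer all of whose prime divisors are congruent to 1 mod 4. For each prime p and n ≥ 1, let N(pⁿ) = #{(x₀,x₁,x₂) ∈ (ℤ/pⁿℤ)³ : (x₀,x₁,x₂) ≢ (0,0,0) (mod p) and x₀² + x₁² ≡ t·x₂² (mod pⁿ)}, and set σ_p = lim_{n→∞} N(pⁿ)/p^{2n}. Then each limit σ_p exists; σ₂ = 1; σ_p = 2(1 − 1/p) for every prime p dividing t; σ_p = 1 − p^{−2} for every odd prime p not dividing t; the infinite product ∏_p σ_p converges and equals ∏_{p ∣ t} 2(1 − 1/p) · ∏_{p ∤ 2t} (1 − 1/p²); and ∏_p σ_p ≥ (4/3)^{ω(t)}/ζ(2), where ω(t) is the number of prime factors of t. -/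

import Mathlib

noncomputable section

open Filter Topology

namespace Stmt

def Ncong (t : ℕ) (p q : ℕ) : ℕ :=
  Nat.card {v : Fin 3 → ZMod q //
    (¬ ∀ i, (p : ZMod q) ∣ v i) ∧ v 0 ^ 2 + v 1 ^ 2 = (t : ZMod q) * v 2 ^ 2}

theorem count_gen {R : Type*} [CommRing R] [Finite R] (c : R)
    (h : ∀ u v w : R, ¬ IsUnit u → ¬ IsUnit v → u * v = c * w ^ 2 → ¬ IsUnit w) :
    Nat.card {x : R × R × R // (IsUnit x.1 ∨ IsUnit x.2.1 ∨ IsUnit x.2.2) ∧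
      x.1 * x.2.1 = c * x.2.2 ^ 2} =
    Nat.card Rˣ * Nat.card R + Nat.card Rˣ * Nat.card {w : R // ¬ IsUnit (c * w ^ 2)} := by
  rw [← Nat.card_prod, ← Nat.card_prod, ← Nat.card_sum]
  symm
  let f : (Rˣ × R) ⊕ (Rˣ × {w : R // ¬ IsUnit (c * w ^ 2)}) →
    {x : R × R × R // (IsUnit x.1 ∨ IsUnit x.2.1 ∨ IsUnit x.2.2) ∧
      x.1 * x.2.1 = c * x.2.2 ^ 2} := fun s => match s with
    | Sum.inl (u, w) => ⟨((u : R), (↑u⁻¹ : R) * (c * w ^ 2), w), Or.inl u.isUnit, by simp⟩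
    | Sum.inr (v, w) => ⟨((↑v⁻¹ : R) * (c * w.1 ^ 2), (v : R), w.1), Or.inr (Or.inl v.isUnit), by
        simp [mul_comm, mul_left_comm]⟩
  refine Nat.card_congr (Equiv.ofBijective f ⟨?_, ?_⟩)
  · rintro (⟨u, w⟩ | ⟨v, w, hw⟩) (⟨u', w'⟩ | ⟨v', w', hw'⟩) he
    · simp [f] at he
      obtain ⟨h1, -, h3⟩ := he
      simp [Units.ext h1, h3]
    · exfalso
      simp [f] at he
      have := u.isUnit
      rw [he.1] at this
      exact hw' ((Units.isUnit_units_mul _ _).1 this)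
    · exfalso
      simp [f] at he
      have := u'.isUnit
      rw [← he.1] at this
      exact hw ((Units.isUnit_units_mul _ _).1 this)
    · simp [f] at he
      obtain ⟨h1, h2, h3⟩ := he
      simp [Units.ext h2, h3]
  · rintro ⟨⟨u, v, w⟩, h1, h2⟩
    simp only at h1 h2
    by_cases hu : IsUnit u
    · obtain ⟨u, rfl⟩ := hu
      refine ⟨Sum.inl (u, w), ?_⟩
      simp [f, ← h2]
    · have hv : IsUnit v := by
        by_contra hv
        have := h u v w hu hv h2
        tauto
      obtain ⟨v, rfl⟩ := hv
      refine ⟨Sum.inr (v, ⟨w, ?_⟩), ?_⟩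
      · rw [← h2]; simpa using hu
      · simp [f, ← h2, mul_comm]

theorem dvd_iff_not_unit {p n : ℕ} (hp : p.Prime) (hn : n ≠ 0) (x : ZMod (p ^ n)) :
    (p : ZMod (p ^ n)) ∣ x ↔ ¬ IsUnit x := by
  have : NeZero (p ^ n) := ⟨pow_ne_zero _ hp.ne_zero⟩
  obtain ⟨m, rfl⟩ := ZMod.natCast_zmod_surjective x
  rw [ZMod.isUnit_iff_coprime, Nat.coprime_pow_right_iff (Nat.pos_of_ne_zero hn), Nat.coprime_comm, hp.coprime_iff_not_dvd, not_not]
  constructor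
  · rintro ⟨k, hk⟩
    obtain ⟨k, rfl⟩ := ZMod.natCast_zmod_surjective k
    rw [← Nat.cast_mul, ZMod.natCast_eq_natCast_iff] at hk
    have := hk.of_dvd (dvd_pow_self p hn)
    rw [← Nat.modEq_zero_iff_dvd]
    exact this.trans (by simp [Nat.ModEq])
  · rintro ⟨k, rfl⟩
    exact ⟨k, by simp⟩

theorem card_units' {p n : ℕ} (hp : p.Prime) (hn : n ≠ 0) :
    Nat.card (ZMod (p ^ n))ˣ = p ^ (n - 1) * (p - 1) := by
  have : NeZero (p ^ n) := ⟨pow_ne_zero _ hp.ne_zero⟩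
  rw [Nat.card_eq_fintype_card, ZMod.card_units_eq_totient, Nat.totient_prime_pow hp (Nat.pos_of_ne_zero hn)]

theorem card_isUnit {p n : ℕ} (hp : p.Prime) (hn : n ≠ 0) :
    Nat.card {w : ZMod (p ^ n) // IsUnit w} = p ^ (n - 1) * (p - 1) := by
  rw [← card_units' hp hn]
  exact Nat.card_congr (Equiv.ofBijective (fun u : (ZMod (p ^ n))ˣ => (⟨u, u.isUnit⟩ : {w : ZMod (p ^ n) // IsUnit w}))
    ⟨fun a b h => Units.ext (congrArg Subtype.val h), fun ⟨_, u, hu⟩ => ⟨u, Subtype.ext hu⟩⟩).symm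

theorem card_nonunit {p n : ℕ} (hp : p.Prime) (hn : n ≠ 0) :
    Nat.card {w : ZMod (p ^ n) // ¬ IsUnit w} = p ^ (n - 1) := by
  classical
  have : NeZero (p ^ n) := ⟨pow_ne_zero _ hp.ne_zero⟩
  have h1 := card_isUnit hp hn
  have h2 : Nat.card {w : ZMod (p ^ n) // IsUnit w} + Nat.card {w : ZMod (p ^ n) // ¬ IsUnit w} = p ^ n := by
    rw [← Nat.card_sum, Nat.card_congr (Equiv.sumCompl _), Nat.card_zmod]
  obtain ⟨m, rfl⟩ := Nat.exists_eq_succ_of_ne_zero hn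
  obtain ⟨k, rfl⟩ := Nat.exists_eq_succ_of_ne_zero hp.ne_zero
  simp at *
  rw [h1] at h2
  ring_nf at *
  omega

theorem exists_i {p : ℕ} (hp : p.Prime) (h : p % 4 = 1) (n : ℕ) : ∃ i : ZMod (p ^ n), i ^ 2 = -1 := by
  have := Fact.mk hp
  obtain ⟨r, hr⟩ := (ZMod.exists_sq_eq_neg_one_iff (p := p)).2 (by omega)
  obtain ⟨r, rfl⟩ := ZMod.intCast_surjective r
  rcases n with _ | n
  · exact ⟨0, by simp; exact (Subsingleton.elim (α := ZMod 1) _ _)⟩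
  have h1 : (p : ℤ) ∣ r ^ 2 - (-1) := by
    rw [← ZMod.intCast_zmod_eq_zero_iff_dvd]
    push_cast
    rw [sq, ← hr]; ring
  have h2 := dvd_sub_pow_of_dvd_sub h1 n
  have hodd : Odd (p ^ n) := Odd.pow (Nat.odd_iff.2 (by omega))
  rw [hodd.neg_one_pow] at h2
  have h3 : (((p ^ (n+1) : ℕ)) : ℤ) ∣ (r ^ 2) ^ p ^ n - (-1) := by exact_mod_cast h2
  rw [← ZMod.intCast_zmod_eq_zero_iff_dvd] at h3
  refine ⟨(r : ZMod _) ^ p ^ n, ?_⟩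
  push_cast at h3
  rw [pow_right_comm]
  linear_combination h3

theorem isUnit_natCast' {p n t : ℕ} (hp : p.Prime) (ht : ¬ p ∣ t) : IsUnit (t : ZMod (p ^ n)) := by
  rw [ZMod.isUnit_iff_coprime]
  exact Nat.Coprime.pow_right _ ((hp.coprime_iff_not_dvd.2 ht).symm)

theorem Ncong_good {p n t a b : ℕ} (hp : p.Prime) (hn : n ≠ 0) (hp2 : p ≠ 2) (hpt : ¬ p ∣ t)
    (hab : t = a ^ 2 + b ^ 2) :
    Ncong t p (p ^ n) = p ^ (n - 1) * (p - 1) * p ^ n + p ^ (n - 1) * (p - 1) * p ^ (n - 1) := by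
  have : NeZero (p ^ n) := ⟨pow_ne_zero _ hp.ne_zero⟩
  have key := count_gen (1 : ZMod (p ^ n)) (by
    intro u v w hu hv h hw
    rw [one_mul] at h
    have : IsUnit (u * v) := by rw [h]; exact hw.pow 2
    exact hu (isUnit_of_mul_isUnit_left this))
  have e : Nat.card {w : ZMod (p ^ n) // ¬ IsUnit (1 * w ^ 2)} = p ^ (n - 1) := by
    rw [← card_nonunit hp hn]
    refine Nat.card_congr (Equiv.subtypeEquivRight fun w => ?_)
    rw [one_mul, isUnit_pow_iff two_ne_zero]
  rw [e, card_units' hp hn, Nat.card_zmod] at key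
  rw [← key, Ncong]
  obtain ⟨s, hs⟩ := (isUnit_natCast' (n := n) hp hpt).exists_right_inv
  obtain ⟨h, hh⟩ := (isUnit_natCast' (n := n) (t := 2) hp (by
    intro h; exact hp2 ((Nat.prime_dvd_prime_iff_eq hp Nat.prime_two).1 h))).exists_right_inv
  have hab' : (t : ZMod (p ^ n)) = a ^ 2 + b ^ 2 := by rw [hab]; push_cast; rfl
  push_cast at hh
  generalize (t : ZMod (p ^ n)) = T at *
  generalize (a : ZMod (p ^ n)) = A at *
  generalize (b : ZMod (p ^ n)) = B at *
  let E : (Fin 3 → ZMod (p ^ n)) ≃ ZMod (p ^ n) × ZMod (p ^ n) × ZMod (p ^ n) :=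
    { toFun := fun x => (T * x 2 - (A * x 0 + B * x 1), T * x 2 + (A * x 0 + B * x 1), A * x 1 - B * x 0)
      invFun := fun y => ![s * (A * (h * (y.2.1 - y.1)) - B * y.2.2),
        s * (B * (h * (y.2.1 - y.1)) + A * y.2.2), s * h * (y.1 + y.2.1)]
      left_inv := by
        intro x
        ext i
        fin_cases i <;> simp <;> grind
      right_inv := by
        rintro ⟨u, v, w⟩
        simp
        refine ⟨?_, ?_, ?_⟩ <;> grind }
  refine Nat.card_congr (E.subtypeEquiv fun x => and_congr ?_ ?_)
  · have : (∀ i, (p : ZMod (p ^ n)) ∣ x i) ↔ ((p : ZMod (p ^ n)) ∣ (E x).1 ∧ (p : ZMod (p ^ n)) ∣ (E x).2.1 ∧ (p : ZMod (p ^ n)) ∣ (E x).2.2) := by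
      constructor
      · intro hx
        exact ⟨dvd_sub ((hx 2).mul_left _) (dvd_add ((hx 0).mul_left _) ((hx 1).mul_left _)),
          dvd_add ((hx 2).mul_left _) (dvd_add ((hx 0).mul_left _) ((hx 1).mul_left _)),
          dvd_sub ((hx 1).mul_left _) ((hx 0).mul_left _)⟩
      · rintro ⟨h1, h2, h3⟩
        rw [← E.symm_apply_apply x]
        generalize E x = y at *
        have h4 := (dvd_sub h2 h1).mul_left h
        intro i
        fin_cases i
        · exact (dvd_sub (h4.mul_left A) (h3.mul_left B)).mul_left s
        · exact (dvd_add (h4.mul_left B) (h3.mul_left A)).mul_left s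
        · exact (dvd_add h1 h2).mul_left _
    rw [this]
    simp only [dvd_iff_not_unit hp hn]
    tauto
  · simp only [E, Equiv.coe_fn_mk]
    constructor <;> intro hx <;> grind

theorem Ncong_bad {p n t : ℕ} (hp : p.Prime) (hn : 2 ≤ n) (hp4 : p % 4 = 1) (hpt : p ∣ t)
    (hpt2 : ¬ p * p ∣ t) :
    Ncong t p (p ^ n) = 2 * (p ^ (n - 1) * (p - 1) * p ^ n) := by
  have hn0 : n ≠ 0 := by omega
  have : NeZero (p ^ n) := ⟨pow_ne_zero _ hp.ne_zero⟩
  have htn : ¬ IsUnit (t : ZMod (p ^ n)) := by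
    rw [← dvd_iff_not_unit hp hn0]; exact Nat.cast_dvd_cast hpt
  have key := count_gen (t : ZMod (p ^ n)) (by
    intro u v w hu hv h hw
    rw [← dvd_iff_not_unit hp hn0] at hu hv
    have h1 : (p : ZMod (p ^ n)) * p ∣ t * w ^ 2 := by rw [← h]; exact mul_dvd_mul hu hv
    rw [(hw.pow 2).dvd_mul_right] at h1
    obtain ⟨k, hk⟩ := h1
    obtain ⟨k, rfl⟩ := ZMod.natCast_zmod_surjective k
    rw [← Nat.cast_mul, ← Nat.cast_mul, ZMod.natCast_eq_natCast_iff] at hk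
    have h2 : p * p ∣ p ^ n := by rw [← sq]; exact pow_dvd_pow _ hn
    have := hk.of_dvd h2
    apply hpt2
    rw [← Nat.modEq_zero_iff_dvd]
    exact this.trans (by simp [Nat.ModEq]))
  have e : Nat.card {w : ZMod (p ^ n) // ¬ IsUnit ((t : ZMod (p ^ n)) * w ^ 2)} = p ^ n := by
    refine Eq.trans ?_ (Nat.card_zmod (p ^ n))
    exact Nat.card_congr (Equiv.subtypeUnivEquiv fun w hw => htn (isUnit_of_mul_isUnit_left hw))
  rw [e, card_units' hp hn0, Nat.card_zmod, ← two_mul] at key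
  rw [← key, Ncong]
  obtain ⟨j, hj⟩ := exists_i hp hp4 n
  obtain ⟨h, hh⟩ := (isUnit_natCast' (n := n) (t := 2) hp (by
    intro h; have := (Nat.prime_dvd_prime_iff_eq hp Nat.prime_two).1 h; omega)).exists_right_inv
  push_cast at hh
  let E : (Fin 3 → ZMod (p ^ n)) ≃ ZMod (p ^ n) × ZMod (p ^ n) × ZMod (p ^ n) :=
    { toFun := fun x => (x 0 + j * x 1, x 0 - j * x 1, x 2)
      invFun := fun y => ![h * (y.1 + y.2.1), h * j * (y.2.1 - y.1), y.2.2]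
      left_inv := by
        intro x
        ext i
        fin_cases i <;> simp <;> grind
      right_inv := by
        rintro ⟨u, v, w⟩
        simp
        refine ⟨?_, ?_⟩ <;> grind }
  refine Nat.card_congr (E.subtypeEquiv fun x => and_congr ?_ ?_)
  · have : (∀ i, (p : ZMod (p ^ n)) ∣ x i) ↔ ((p : ZMod (p ^ n)) ∣ (E x).1 ∧ (p : ZMod (p ^ n)) ∣ (E x).2.1 ∧ (p : ZMod (p ^ n)) ∣ (E x).2.2) := by
      constructor
      · intro hx
        exact ⟨dvd_add (hx 0) ((hx 1).mul_left _), dvd_sub (hx 0) ((hx 1).mul_left _), hx 2⟩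
      · rintro ⟨h1, h2, h3⟩
        rw [← E.symm_apply_apply x]
        generalize E x = y at *
        intro i
        fin_cases i
        · exact (dvd_add h1 h2).mul_left _
        · exact (dvd_sub h2 h1).mul_left _
        · exact h3
    rw [this]
    simp only [dvd_iff_not_unit hp hn0]
    tauto
  · simp only [E, Equiv.coe_fn_mk]
    constructor <;> intro hx <;> grind

theorem card_sigma_const {α β : Type*} [Finite α] [Finite β] (f : α → β) (k : ℕ)
    (h : ∀ y, Nat.card {x // f x = y} = k) : Nat.card α = Nat.card β * k := by
  have := Fintype.ofFinite β
  rw [← Nat.card_congr (Equiv.sigmaFiberEquiv f), Nat.card_sigma]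
  simp [h]

theorem two_fiber {n : ℕ} (φ : ZMod (2 ^ (n + 3)) →+* ZMod 8) (y : ZMod 8) :
    Nat.card {x // φ x = y} = 2 ^ n := by
  have : NeZero (2 ^ (n + 3)) := ⟨pow_ne_zero _ two_ne_zero⟩
  have hs : Function.Surjective φ := ZMod.ringHom_surjective φ
  have h0 : ∀ y, Nat.card {x // φ x = y} = Nat.card {x // φ x = 0} := by
    intro y
    obtain ⟨x, rfl⟩ := hs y
    refine Nat.card_congr ((Equiv.subRight x).subtypeEquiv fun z => ?_)
    simp [sub_eq_zero]
  have h1 := card_sigma_const φ _ h0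
  rw [Nat.card_zmod, Nat.card_zmod] at h1
  rw [h0]
  have h2 : 2 ^ (n + 3) = 2 ^ n * 8 := by ring
  have h3 := h2.symm.trans h1
  omega

theorem two_count {n : ℕ} (φ : ZMod (2 ^ (n + 3)) →+* ZMod 8) (Q : ZMod 8 → Prop) :
    Nat.card {x // Q (φ x)} = Nat.card {y // Q y} * 2 ^ n := by
  have : NeZero (2 ^ (n + 3)) := ⟨pow_ne_zero _ two_ne_zero⟩
  refine card_sigma_const (fun x : {x // Q (φ x)} => (⟨φ x.1, x.2⟩ : {y // Q y})) _ ?_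
  rintro ⟨y, hy⟩
  rw [← two_fiber φ y]
  refine Nat.card_congr ⟨fun x => ⟨x.1.1, congrArg Subtype.val x.2⟩,
    fun x => ⟨⟨x.1, by rw [x.2]; exact hy⟩, Subtype.ext x.2⟩, fun x => rfl, fun x => rfl⟩

theorem int_root (c : ℤ) (hc : c % 8 = 1) (n : ℕ) : ∃ x : ℤ, (2 : ℤ) ^ (n + 3) ∣ x ^ 2 - c := by
  suffices ∃ x : ℤ, x % 2 = 1 ∧ (2 : ℤ) ^ (n + 3) ∣ x ^ 2 - c by
    obtain ⟨x, -, h⟩ := this; exact ⟨x, h⟩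
  induction n with
  | zero => exact ⟨1, by norm_num, by norm_num; omega⟩
  | succ n ih =>
    obtain ⟨x, hx, k, hk⟩ := ih
    obtain ⟨m, hm⟩ : ∃ m, x = 2 * m + 1 := ⟨x / 2, by omega⟩
    rcases Int.even_or_odd' k with ⟨l, rfl | rfl⟩
    · exact ⟨x, hx, l, by rw [hk]; ring⟩
    · refine ⟨x + 2 ^ (n + 2), ?_, l + m + 1 + 2 ^ n, ?_⟩
      · rw [pow_succ]; omega
      · have : (x + 2 ^ (n + 2)) ^ 2 - c = (x ^ 2 - c) + x * 2 ^ (n + 3) + 2 ^ n * 2 ^ (n + 4) := by ring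
        rw [this, hk, hm]; ring

theorem zmod_root {n : ℕ} (φ : ZMod (2 ^ (n + 3)) →+* ZMod 8) (c : ZMod (2 ^ (n + 3)))
    (hc : φ c = 1) : ∃ r, r ^ 2 = c := by
  obtain ⟨c, rfl⟩ := ZMod.intCast_surjective c
  rw [map_intCast] at hc
  have : c % 8 = 1 := by
    have := (ZMod.intCast_eq_intCast_iff c 1 8).1 (by simpa using hc)
    simpa [Int.ModEq] using this
  obtain ⟨x, hx⟩ := int_root c this n
  refine ⟨x, ?_⟩
  have h3 : (((2 ^ (n+3) : ℕ)) : ℤ) ∣ x ^ 2 - c := by exact_mod_cast hx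
  rw [← ZMod.intCast_zmod_eq_zero_iff_dvd] at h3
  push_cast at h3
  linear_combination h3

theorem unit_of_phi {n : ℕ} (φ : ZMod (2 ^ (n + 3)) →+* ZMod 8) (x : ZMod (2 ^ (n + 3))) :
    IsUnit x ↔ φ x ^ 2 = 1 := by
  constructor
  · intro h
    have h1 : IsUnit (φ x) := h.map φ
    revert h1
    generalize φ x = y
    revert y
    decide
  · intro h
    rw [← map_pow] at h
    by_contra hx
    have h2 := (dvd_iff_not_unit Nat.prime_two (by omega) x).2 hx
    have h3 := map_dvd φ h2
    rw [map_pow] at h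
    rw [map_natCast] at h3
    revert h h3
    generalize φ x = y
    rintro h ⟨z, rfl⟩
    revert z
    decide

theorem root_count {n : ℕ} (φ : ZMod (2 ^ (n + 3)) →+* ZMod 8) (c : ZMod (2 ^ (n + 3)))
    (hc : φ c = 1) : Nat.card {z // z ^ 2 = c} = 4 := by
  have : NeZero (2 ^ (n + 3)) := ⟨pow_ne_zero _ two_ne_zero⟩
  have h0 : ∀ c : ZMod (2 ^ (n + 3)), φ c = 1 → Nat.card {z // z ^ 2 = c} = Nat.card {z : ZMod (2 ^ (n + 3)) // z ^ 2 = 1} := by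
    intro c hc
    obtain ⟨r, rfl⟩ := zmod_root φ c hc
    have hr : IsUnit r := by rw [unit_of_phi φ, ← map_pow]; exact hc
    obtain ⟨r, rfl⟩ := hr
    refine Nat.card_congr ((Units.mulLeft r⁻¹).subtypeEquiv fun z => ?_)
    have : z ^ 2 = (↑r * (↑r⁻¹ * z)) ^ 2 := by simp
    simp only [Units.mulLeft_apply]
    rw [this, mul_pow]
    constructor
    · intro h
      exact (r ^ 2).isUnit.mul_left_cancel (by simpa using h)
    · intro h; rw [h]; simp
  rw [h0 c hc]
  have h1 := card_sigma_const (fun x : {x // φ x ^ 2 = 1} => (⟨x.1 ^ 2, by rw [map_pow]; exact x.2⟩ : {c // φ c = 1}))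
    (Nat.card {z : ZMod (2 ^ (n + 3)) // z ^ 2 = 1}) (by
      rintro ⟨y, hy⟩
      rw [← h0 y hy]
      exact Nat.card_congr ⟨fun x => ⟨x.1.1, congrArg Subtype.val x.2⟩,
        fun x => ⟨⟨x.1, by rw [← map_pow, x.2]; exact hy⟩, Subtype.ext x.2⟩, fun x => rfl, fun x => rfl⟩)
  rw [two_fiber φ 1, two_count φ (fun y => y ^ 2 = 1)] at h1
  have h2 : Nat.card {y : ZMod 8 // y ^ 2 = 1} = 4 := by
    rw [Nat.card_eq_fintype_card]; decide
  rw [h2, mul_comm] at h1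
  exact (Nat.eq_of_mul_eq_mul_left (by positivity) h1).symm

theorem Ncong_two {n t : ℕ} (ht : t % 4 = 1) : Ncong t 2 (2 ^ (n + 3)) = 2 ^ (2 * (n + 3)) := by
  have : NeZero (2 ^ (n + 3)) := ⟨pow_ne_zero _ two_ne_zero⟩
  have h8 : 8 ∣ 2 ^ (n + 3) := ⟨2 ^ n, by ring⟩
  let φ : ZMod (2 ^ (n + 3)) →+* ZMod 8 := ZMod.castHom h8 _
  have hT : (t : ZMod 8) = 1 ∨ (t : ZMod 8) = 5 := by
    have : t % 8 = 1 ∨ t % 8 = 5 := by omega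
    rcases this with h | h
    · left; rw [← Nat.cast_one, ZMod.natCast_eq_natCast_iff]; exact h
    · right; exact (ZMod.natCast_eq_natCast_iff t 5 8).2 h
  let X := {x : ZMod (2 ^ (n + 3)) × ZMod (2 ^ (n + 3)) × ZMod (2 ^ (n + 3)) //
    (t - φ x.2.1 ^ 2 = 1 ∧ φ x.2.2 ^ 2 = 1) ∧ x.1 ^ 2 + x.2.1 ^ 2 = t * x.2.2 ^ 2}
  have hX : Nat.card X = 2 * 2 ^ n * (4 * 2 ^ n) * 4 := by
    have hA : Nat.card {y : ZMod 8 // t - y ^ 2 = 1} = 2 := by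
      rcases hT with h | h <;> rw [h, Nat.card_eq_fintype_card] <;> decide
    have hB : Nat.card {y : ZMod 8 // y ^ 2 = 1} = 4 := by
      rw [Nat.card_eq_fintype_card]; decide
    have := card_sigma_const (fun x : X => ((⟨x.1.2.1, x.2.1.1⟩, ⟨x.1.2.2, x.2.1.2⟩) :
      {x // t - φ x ^ 2 = 1} × {x // φ x ^ 2 = 1})) 4 (by
      rintro ⟨⟨y, hy⟩, ⟨z, hz⟩⟩
      rw [← root_count φ (t * z ^ 2 - y ^ 2) (by simp [hz, hy])]
      refine Nat.card_congr ⟨fun x => ⟨x.1.1.1, ?_⟩, fun x => ⟨⟨(x.1, y, z), ⟨hy, hz⟩, ?_⟩, rfl⟩, ?_, ?_⟩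
      · have h1 := x.1.2.2
        have h2 := x.2
        simp only [Prod.mk.injEq, Subtype.mk.injEq] at h2
        rw [h2.1, h2.2] at h1
        linear_combination h1
      · have := x.2
        simp only
        linear_combination this
      · rintro ⟨⟨⟨a, b, c⟩, h1⟩, h2⟩
        simp only [Prod.mk.injEq, Subtype.mk.injEq] at h2
        obtain ⟨rfl, rfl⟩ := h2
        rfl
      · intro x; rfl)
    rw [this, Nat.card_prod, two_count φ (fun y => t - y ^ 2 = 1), two_count φ (fun y => y ^ 2 = 1), hA, hB]
  have hodd : ∀ v : Fin 3 → ZMod (2 ^ (n + 3)), (¬ ∀ i, ((2 : ℕ) : ZMod (2 ^ (n + 3))) ∣ v i) ↔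
      (φ (v 0) ^ 2 = 1 ∨ φ (v 1) ^ 2 = 1 ∨ φ (v 2) ^ 2 = 1) := by
    intro v
    simp only [dvd_iff_not_unit Nat.prime_two (show n + 3 ≠ 0 by omega), unit_of_phi φ, Fin.forall_fin_succ]
    simp
    tauto
  have hmain : Nat.card (X ⊕ X) = Ncong t 2 (2 ^ (n + 3)) := by
    let f : X ⊕ X → {v : Fin 3 → ZMod (2 ^ (n + 3)) //
      (¬ ∀ i, ((2 : ℕ) : ZMod (2 ^ (n + 3))) ∣ v i) ∧ v 0 ^ 2 + v 1 ^ 2 = (t : ZMod (2 ^ (n + 3))) * v 2 ^ 2} :=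
      fun s => match s with
      | Sum.inl x => ⟨![x.1.1, x.1.2.1, x.1.2.2], (hodd _).2 (Or.inr (Or.inr x.2.1.2)), x.2.2⟩
      | Sum.inr x => ⟨![x.1.2.1, x.1.1, x.1.2.2], (hodd _).2 (Or.inr (Or.inr x.2.1.2)), by
          exact (add_comm _ _).trans x.2.2⟩
    have dis : ∀ (T a b c : ZMod 8), (T = 1 ∨ T = 5) → T - b ^ 2 = 1 → c ^ 2 = 1 → a ^ 2 + b ^ 2 = T * c ^ 2 →
      T - a ^ 2 ≠ 1 := by decide
    have cov : ∀ (T a b c : ZMod 8), (T = 1 ∨ T = 5) → (a ^ 2 = 1 ∨ b ^ 2 = 1 ∨ c ^ 2 = 1) → a ^ 2 + b ^ 2 = T * c ^ 2 →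
      c ^ 2 = 1 ∧ (T - b ^ 2 = 1 ∨ T - a ^ 2 = 1) := by decide
    refine Nat.card_congr (Equiv.ofBijective f ⟨?_, ?_⟩)
    · rintro (⟨⟨a, b, c⟩, h, h'⟩ | ⟨⟨a, b, c⟩, h, h'⟩) (⟨⟨a', b', c'⟩, k, k'⟩ | ⟨⟨a', b', c'⟩, k, k'⟩) he
      · simp [f] at he
        simp [he]
      · exfalso
        simp [f] at he
        obtain ⟨rfl, rfl, rfl⟩ := he
        exact dis t (φ a) (φ b) (φ c) hT h.1 h.2 (by simpa using congrArg φ h') k.1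
      · exfalso
        simp [f] at he
        obtain ⟨rfl, rfl, rfl⟩ := he
        exact dis t (φ a) (φ b) (φ c) hT h.1 h.2 (by simpa using congrArg φ h') k.1
      · simp [f] at he
        simp [he]
    · rintro ⟨v, h1, h2⟩
      have h3 := cov t _ _ _ hT ((hodd v).1 h1) (by simpa using congrArg φ h2)
      rcases h3 with ⟨h3, h4 | h4⟩
      · refine ⟨Sum.inl ⟨(v 0, v 1, v 2), ⟨h4, h3⟩, h2⟩, ?_⟩
        apply Subtype.ext
        ext i
        fin_cases i <;> rfl
      · refine ⟨Sum.inr ⟨(v 1, v 0, v 2), ⟨h4, h3⟩, by rw [← h2]; simp [add_comm]⟩, ?_⟩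
        apply Subtype.ext
        ext i
        fin_cases i <;> rfl
  rw [← hmain, Nat.card_sum, hX]
  ring

theorem primes_hasProd : HasProd (fun p : Nat.Primes => (1 - 1 / ((p : ℕ) : ℝ) ^ 2)) (Real.pi ^ 2 / 6)⁻¹ := by
  have h := riemannZeta_eulerProduct_hasProd (s := 2) (by norm_num)
  rw [riemannZeta_two] at h
  have h' : HasProd (fun p : Nat.Primes => (1 - 1 / ((p : ℕ) : ℝ) ^ 2)⁻¹) (Real.pi ^ 2 / 6) := by
    rw [HasProd] at h ⊢
    have h2 := (Complex.continuous_re.tendsto _).comp h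
    convert h2 using 2
    · rename_i s
      simp only [Function.comp]
      rw [← Complex.ofReal_re (∏ b ∈ s, _)]
      congr 1
      push_cast
      refine Finset.prod_congr rfl fun p _ => ?_
      rw [Complex.cpow_neg]
      simp
    · rw [← Complex.ofReal_re (Real.pi ^ 2 / 6)]
      push_cast; rfl
  rw [HasProd] at h' ⊢
  have := h'.inv₀ (by positivity)
  simpa using this

theorem statement_17
    (t : ℕ) (htpos : 0 < t) (htsf : Squarefree t)
    (ht : ∀ p ∈ t.primeFactors, p % 4 = 1) :
    ∃ σ : ℕ → ℝ,
      (∀ p : ℕ, p.Prime →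
        Tendsto (fun n : ℕ => (Ncong t p (p ^ n) : ℝ) / (p : ℝ) ^ (2 * n))
          atTop (𝓝 (σ p))) ∧
      σ 2 = 1 ∧
      (∀ p : ℕ, p.Prime → p ∣ t → σ p = 2 * (1 - 1 / (p : ℝ))) ∧
      (∀ p : ℕ, p.Prime → p ≠ 2 → ¬ p ∣ t → σ p = 1 - 1 / (p : ℝ) ^ 2) ∧
      Multipliable (fun p : Nat.Primes => σ (p : ℕ)) ∧
      (∏' p : Nat.Primes, σ (p : ℕ)) =
        (∏ p ∈ t.primeFactors, 2 * (1 - 1 / (p : ℝ))) *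
          ∏' p : {p : Nat.Primes // ¬ (p : ℕ) ∣ 2 * t}, (1 - 1 / ((p.1 : ℕ) : ℝ) ^ 2) ∧
      (4 / 3 : ℝ) ^ t.primeFactors.card / (Real.pi ^ 2 / 6) ≤
        ∏' p : Nat.Primes, σ (p : ℕ) := by
  have ht4 : ∀ p : ℕ, p.Prime → p ∣ t → p % 4 = 1 := fun p hp h =>
    ht p (Nat.mem_primeFactors.2 ⟨hp, h, htpos.ne'⟩)
  have h2t : ¬ 2 ∣ t := fun h => by have := ht4 2 Nat.prime_two h; omega
  have ht1 : t % 4 = 1 := by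
    have key : ∀ s : Finset ℕ, (∀ p ∈ s, p % 4 = 1) → (∏ p ∈ s, p) % 4 = 1 := by
      intro s
      induction s using Finset.induction_on with
      | empty => simp
      | insert a s ha ih =>
        intro h
        rw [Finset.prod_insert ha, Nat.mul_mod, h a (by simp), ih fun p hp => h p (by simp [hp])]
    rw [← Nat.prod_primeFactors_of_squarefree htsf]
    exact key _ ht
  obtain ⟨a, b, hab⟩ : ∃ a b, t = a ^ 2 + b ^ 2 := Nat.eq_sq_add_sq_iff.2 fun q hq h => by
    have := ht q hq; omega
  let σ : ℕ → ℝ := fun p => if p = 2 then 1 else if p ∣ t then 2 * (1 - 1 / (p : ℝ)) else 1 - 1 / (p : ℝ) ^ 2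
  have s2 : σ 2 = 1 := by simp [σ]
  have sb : ∀ p : ℕ, p ∣ t → σ p = 2 * (1 - 1 / (p : ℝ)) := by
    intro p hpt
    have : p ≠ 2 := by rintro rfl; exact h2t hpt
    simp [σ, this, hpt]
  have sg : ∀ p : ℕ, p ≠ 2 → ¬ p ∣ t → σ p = 1 - 1 / (p : ℝ) ^ 2 := by
    intro p h1 h2
    simp [σ, h1, h2]
  -- the finite set of primes dividing t
  let S : Finset Nat.Primes := t.primeFactors.attach.map
    ⟨fun p => ⟨p.1, Nat.prime_of_mem_primeFactors p.2⟩, fun p q h => by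
      exact Subtype.ext (congrArg (fun x : Nat.Primes => (x : ℕ)) h)⟩
  have hS : ∀ p : Nat.Primes, p ∈ S ↔ (p : ℕ) ∣ t := by
    intro p
    simp only [S, Finset.mem_map, Finset.mem_attach, true_and, Function.Embedding.coeFn_mk, Subtype.exists]
    constructor
    · rintro ⟨a, ha, rfl⟩; exact Nat.dvd_of_mem_primeFactors ha
    · intro h; exact ⟨p, Nat.mem_primeFactors.2 ⟨p.2, h, htpos.ne'⟩, rfl⟩
  have hSp : ∀ g : ℕ → ℝ, ∏ p ∈ S, g p = ∏ p ∈ t.primeFactors, g p := by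
    intro g
    rw [Finset.prod_map]
    exact Finset.prod_attach _ _
  have fin : ∀ g : ℕ → ℝ, HasProd (fun p : Nat.Primes => if (p : ℕ) ∣ t then g p else 1) (∏ p ∈ t.primeFactors, g p) := by
    intro g
    rw [← hSp]
    have := hasProd_prod_of_ne_finset_one (f := fun p : Nat.Primes => if (p : ℕ) ∣ t then g p else 1) (s := S)
      (L := SummationFilter.unconditional _)
      (fun p hp => by rw [hS] at hp; simp [hp])
    convert this using 1
    exact Finset.prod_congr rfl fun p hp => by rw [hS] at hp; simp [hp]
  have hB : Multipliable (fun p : Nat.Primes => if ¬ (p : ℕ) ∣ 2 * t then 1 - 1 / ((p : ℕ) : ℝ) ^ 2 else 1) := by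
    have hsum : Summable (fun p : Nat.Primes => if ¬ (p : ℕ) ∣ 2 * t then - (1 / ((p : ℕ) : ℝ) ^ 2) else 0) := by
      have h1 : Summable (fun p : Nat.Primes => 1 / ((p : ℕ) : ℝ) ^ 2) :=
        (Real.summable_one_div_nat_pow.2 one_lt_two).comp_injective (i := fun p : Nat.Primes => (p : ℕ)) Nat.Primes.coe_nat_injective
      refine Summable.of_norm_bounded h1 fun p => ?_
      split_ifs
      · simp
      · rw [norm_neg, Real.norm_of_nonneg (by positivity)]
    have := Real.multipliable_one_add_of_summable hsum
    convert this using 2 with p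
    split_ifs <;> ring
  have hBv : (∏' p : {p : Nat.Primes // ¬ (p : ℕ) ∣ 2 * t}, (1 - 1 / ((p.1 : ℕ) : ℝ) ^ 2)) =
      ∏' p : Nat.Primes, if ¬ (p : ℕ) ∣ 2 * t then 1 - 1 / ((p : ℕ) : ℝ) ^ 2 else 1 := by
    have := tprod_subtype {p : Nat.Primes | ¬ (p : ℕ) ∣ 2 * t} (fun p => (1 - 1 / ((p : ℕ) : ℝ) ^ 2))
    refine this.trans (tprod_congr fun p => ?_)
    simp [Set.mulIndicator]
  have hσ : HasProd (fun p : Nat.Primes => σ (p : ℕ)) ((∏ p ∈ t.primeFactors, 2 * (1 - 1 / (p : ℝ))) *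
          ∏' p : {p : Nat.Primes // ¬ (p : ℕ) ∣ 2 * t}, (1 - 1 / ((p.1 : ℕ) : ℝ) ^ 2)) := by
    rw [hBv]
    convert (fin fun p => 2 * (1 - 1 / (p : ℝ))).mul hB.hasProd using 2 with p
    by_cases h1 : (p : ℕ) ∣ t
    · simp [h1, sb _ h1, Dvd.dvd.mul_left h1 2]
    · by_cases h2 : (p : ℕ) = 2
      · simp [h2, s2, h2t]
      · have : ¬ (p : ℕ) ∣ 2 * t := by
          rw [p.2.dvd_mul, Nat.prime_dvd_prime_iff_eq p.2 Nat.prime_two]; tauto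
        rw [sg _ h2 h1]
        simp [h1, this]
  refine ⟨σ, ?_, s2, fun p _ h => sb p h, fun p _ => sg p, hσ.multipliable, hσ.tprod_eq, ?_⟩
  · intro p hp
    have hp0 : (p : ℝ) ≠ 0 := by exact_mod_cast hp.ne_zero
    by_cases h2 : p = 2
    · subst h2
      rw [s2]
      refine tendsto_const_nhds.congr' ?_
      filter_upwards [eventually_ge_atTop 3] with n hn
      obtain ⟨n, rfl⟩ := Nat.exists_eq_add_of_le' hn
      rw [Ncong_two ht1]
      push_cast
      rw [div_self (by positivity)]
    by_cases h1 : p ∣ t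
    · rw [sb p h1]
      refine tendsto_const_nhds.congr' ?_
      filter_upwards [eventually_ge_atTop 2] with n hn
      rw [Ncong_bad hp hn (ht4 p hp h1) h1 (fun h => hp.not_isUnit (htsf p h))]
      obtain ⟨n, rfl⟩ := Nat.exists_eq_add_of_le' hn
      push_cast [Nat.cast_sub hp.one_le]
      field_simp
      ring
    · rw [sg p h2 h1]
      refine tendsto_const_nhds.congr' ?_
      filter_upwards [eventually_ge_atTop 1] with n hn
      rw [Ncong_good hp (by omega) h2 h1 hab]
      obtain ⟨n, rfl⟩ := Nat.exists_eq_add_of_le' hn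
      push_cast [Nat.cast_sub hp.one_le]
      field_simp
      ring
  · have hD := (fin fun _ => 4 / 3).mul primes_hasProd
    rw [Finset.prod_const] at hD
    rw [hσ.tprod_eq, div_eq_mul_inv]
    refine le_of_tendsto_of_tendsto' hD hσ fun s => Finset.prod_le_prod ?_ ?_
    · intro p _
      have h2 : (2 : ℝ) ≤ (p : ℕ) := by exact_mod_cast p.2.two_le
      have : 1 / ((p : ℕ) : ℝ) ^ 2 ≤ 1 := by
        rw [div_le_one (by positivity)]; nlinarith
      refine mul_nonneg (by split_ifs <;> norm_num) (by linarith)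
    · intro p _
      have h2 : (2 : ℝ) ≤ (p : ℕ) := by exact_mod_cast p.2.two_le
      by_cases h1 : (p : ℕ) ∣ t
      · rw [sb _ h1]
        simp only [h1, if_true]
        have h3 : 1 / ((p : ℕ) : ℝ) ≤ 1 / 2 := by
          apply one_div_le_one_div_of_le <;> linarith
        rw [← one_div_pow]
        nlinarith
      · by_cases h3 : (p : ℕ) = 2
        · rw [h3, s2]; simp [h2t]
        · rw [sg _ h3 h1]; simp [h1]

end Stmt
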